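/- For all real numbers a, b > 0 with a ≠ b, the inequality M(a,b) < (8/25)·(C(a,b)/6 + 5·A(a,b)/6) + (17/25)·C(a,b)^{1/6}·A(a,b)^{5/6} holds. -/

import Mathlib

noncomputable def M (a b : ℝ) : ℝ := (a - b) / (2 * Real.arsinh ((a - b) / (a + b)))
noncomputable def A (a b : ℝ) : ℝ := (a + b) / 2
noncomputable def C (a b : ℝ) : ℝ := (a ^ 2 + b ^ 2) / (a + b)

open Real in
/-- The derivative of `x ↦ (1 + x ^ 2) ^ (1 / 6)`, with the exponent normalized. -/
lemma hasDerivAt_one_add_sq_rpow_sixth (x : ℝ) :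
    HasDerivAt (fun y : ℝ => (1 + y ^ 2) ^ ((1 : ℝ) / 6))
      ((1 + x ^ 2) ^ ((1 : ℝ) / 6) * x / (3 * (1 + x ^ 2))) x := by
  have hx : 0 < 1 + x ^ 2 := by positivity
  have h := (((hasDerivAt_id x).pow 2).const_add 1).rpow_const (p := (1 : ℝ) / 6)
    (Or.inl hx.ne')
  refine h.congr_deriv ?_
  simp only [id, Pi.pow_apply]
  rw [rpow_sub_one hx.ne']
  field_simp
  push_cast
  ring

lemma sixth_root_polynomial_pos {t : ℝ} (ht : 1 < t) :
    75 * (t ^ 5 * (4 * t ^ 6 + 51 * t + 20) - (8 * t ^ 5 + 17) * (t ^ 6 - 1)) <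
      t ^ 2 * (4 * t ^ 6 + 51 * t + 20) ^ 2 := by
  obtain ⟨s, rfl⟩ : ∃ s, t = 1 + s := ⟨t - 1, by ring⟩
  have hs : 0 < s := by linarith
  have h : 0 < 39000 * s ^ 3 + 131475 * s ^ 4 + 213600 * s ^ 5 + 222850 * s ^ 6
      + 169880 * s ^ 7 + 101380 * s ^ 8 + 48940 * s ^ 9 + 19316 * s ^ 10 + 6124 * s ^ 11
      + 1456 * s ^ 12 + 224 * s ^ 13 + 16 * s ^ 14 := by positivity
  linear_combination h

open Real in
lemma div_lt_arsinh {v : ℝ} (hv : 0 < v) :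
    v / (8 / 25 * (1 + v ^ 2 / 6) + 17 / 25 * (1 + v ^ 2) ^ ((1 : ℝ) / 6)) < arsinh v := by
  set g : ℝ → ℝ := fun x => 8 / 25 * (1 + x ^ 2 / 6) + 17 / 25 * (1 + x ^ 2) ^ ((1 : ℝ) / 6)
    with hg
  have g_pos (x : ℝ) : 0 < g x := by positivity
  have hderiv (x : ℝ) : HasDerivAt (fun y => arsinh y - y / g y)
      ((√(1 + x ^ 2))⁻¹ - (1 * g x - x * (8 / 25 * (x / 3) +
        17 / 25 * ((1 + x ^ 2) ^ ((1 : ℝ) / 6) * x / (3 * (1 + x ^ 2))))) / g x ^ 2) x := by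
    refine (hasDerivAt_arsinh x).sub ((hasDerivAt_id x).div ?_ (g_pos x).ne')
    refine HasDerivAt.add (HasDerivAt.const_mul _ ?_)
      ((hasDerivAt_one_add_sq_rpow_sixth x).const_mul _)
    refine ((((hasDerivAt_id x).pow 2).div_const 6).const_add 1).congr_deriv ?_
    simp only [id]
    ring
  have hmono : StrictMonoOn (fun y => arsinh y - y / g y) (Set.Ici 0) := by
    refine strictMonoOn_of_deriv_pos (convex_Ici 0)
      (fun x _ => (hderiv x).continuousAt.continuousWithinAt) fun x hx => ?_
    rw [interior_Ici, Set.mem_Ioi] at hx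
    rw [(hderiv x).deriv]
    simp only [hg]
    set t : ℝ := (1 + x ^ 2) ^ ((1 : ℝ) / 6) with ht
    have ht1 : 1 < t := one_lt_rpow (by nlinarith) (by norm_num)
    have ht6 : 1 + x ^ 2 = t ^ 6 := by
      rw [ht, ← rpow_mul_natCast (by positivity)]
      norm_num
    have hx2 : x ^ 2 = t ^ 6 - 1 := by linarith
    have hsqrt : √(1 + x ^ 2) = t ^ 3 := by
      rw [ht6, show t ^ 6 = (t ^ 3) ^ 2 by ring, sqrt_sq (by positivity)]
    have ht0 : 0 < t := by linarith
    have hpos : 0 < 4 * t ^ 6 + 51 * t + 20 := by positivity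
    have hkey := sixth_root_polynomial_pos ht1
    have heq : (√(1 + x ^ 2))⁻¹ - (1 * (8 / 25 * (1 + x ^ 2 / 6) + 17 / 25 * t) -
        x * (8 / 25 * (x / 3) + 17 / 25 * (t * x / (3 * (1 + x ^ 2))))) /
          (8 / 25 * (1 + x ^ 2 / 6) + 17 / 25 * t) ^ 2 =
        (t ^ 2 * (4 * t ^ 6 + 51 * t + 20) ^ 2 -
          75 * (t ^ 5 * (4 * t ^ 6 + 51 * t + 20) - (8 * t ^ 5 + 17) * (t ^ 6 - 1))) /
          (t ^ 5 * (4 * t ^ 6 + 51 * t + 20) ^ 2) := by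
      have hden : 8 / 25 * (1 + x ^ 2 / 6) + 17 / 25 * t = (4 * t ^ 6 + 51 * t + 20) / 75 := by
        rw [hx2]; ring
      have hnum : x * (8 / 25 * (x / 3) + 17 / 25 * (t * x / (3 * (1 + x ^ 2)))) =
          (8 * t ^ 5 + 17) * (t ^ 6 - 1) / (75 * t ^ 5) := by
        rw [ht6, ← hx2]; field_simp; ring
      rw [hsqrt, hden, hnum]
      field_simp
    rw [heq]
    exact div_pos (by linarith) (by positivity)
  have h := hmono Set.self_mem_Ici hv.le hv
  simp only [arsinh_zero, zero_div, sub_zero] at h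
  exact sub_pos.mp h

lemma M_comm (a b : ℝ) : M a b = M b a := by
  unfold M
  rw [← neg_sub b a, add_comm a b, neg_div (b + a), Real.arsinh_neg, mul_neg, neg_div_neg_eq]

lemma A_comm (a b : ℝ) : A a b = A b a := by
  unfold A
  rw [add_comm]

lemma C_comm (a b : ℝ) : C a b = C b a := by
  unfold C
  rw [add_comm, add_comm a b]

lemma M_lt_of_lt {a b : ℝ} (hb : 0 < b) (hab : b < a) :
    M a b < (8/25) * (C a b / 6 + 5 * A a b / 6) +
      (17/25) * (C a b ^ ((1 : ℝ)/6) * A a b ^ ((5 : ℝ)/6)) := by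
  have hsum : 0 < a + b := by linarith
  have hA : 0 < A a b := by unfold A; positivity
  set v := (a - b) / (a + b) with hv
  have hv0 : 0 < v := div_pos (by linarith) hsum
  have hM : M a b = A a b * (v / Real.arsinh v) := by
    unfold M A
    rw [← hv, hv]
    field_simp
  have hC : C a b = A a b * (1 + v ^ 2) := by
    unfold C A
    rw [hv]
    field_simp
    ring
  have hroot : C a b ^ ((1 : ℝ)/6) * A a b ^ ((5 : ℝ)/6) =
      A a b * (1 + v ^ 2) ^ ((1 : ℝ)/6) := by
    rw [hC, Real.mul_rpow hA.le (by positivity), mul_right_comm, ← Real.rpow_add hA]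
    norm_num
  have hlt : v / Real.arsinh v <
      8 / 25 * (1 + v ^ 2 / 6) + 17 / 25 * (1 + v ^ 2) ^ ((1 : ℝ) / 6) :=
    (div_lt_comm₀ (by positivity) (Real.arsinh_pos_iff.mpr hv0)).mp (div_lt_arsinh hv0)
  rw [hroot, hM, hC]
  linear_combination A a b * hlt

theorem stmt_5 (a b : ℝ) (ha : 0 < a) (hb : 0 < b) (hab : a ≠ b) :
    M a b < (8/25) * (C a b / 6 + 5 * A a b / 6) +
      (17/25) * (C a b ^ ((1 : ℝ)/6) * A a b ^ ((5 : ℝ)/6)) := by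
  rcases hab.lt_or_gt with h | h
  · rw [M_comm, C_comm, A_comm]
    exact M_lt_of_lt ha h
  · exact M_lt_of_lt hb h
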